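/- arXiv:2512.19345 — 2 statements merged into one kernel-verified Lean document; each statement's English description precedes it below -/
import Mathlib

section
/- Let p be an odd prime and let G be a non-Abelian finite p-group such that every non-linear irreducible complex character of G has kernel of order exactly p^m for a fixed integer m ≥ 1. Then the exponent of the derived subgroup G' equals p. -/
open CategoryTheory

/-- The kernel of the character of a complex representation `V` of `G`:
`ker χ = {g ∈ G : χ(g) = χ(1)}`. -/
noncomputable def charKer {G : Type} [Group G] (V : FDRep ℂ G) : Set G :=
  {g | V.character g = V.character 1}

/-- The center of the character of a complex representation `V` of `G`:
`Z(χ) = {g ∈ G : |χ(g)| = χ(1)}`. -/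
noncomputable def charCenter {G : Type} [Group G] (V : FDRep ℂ G) : Set G :=
  {g | (‖V.character g‖ : ℂ) = V.character 1}

open scoped MonoidAlgebra commutatorElement

theorem Subrepresentation.isIrreducible_toRepresentation {k G W : Type*} [Monoid G] [Field k]
    [AddCommGroup W] [Module k W] {ρ : Representation k G W} {σ : Subrepresentation ρ}
    (hσ : IsAtom σ) : σ.toRepresentation.IsIrreducible := by
  let f (τ : Subrepresentation σ.toRepresentation) : Subrepresentation ρ :=
    { toSubmodule := τ.toSubmodule.map σ.toSubmodule.subtype
      apply_mem_toSubmodule := by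
        rintro g _ ⟨v, hv, rfl⟩
        exact ⟨σ.toRepresentation g v, τ.apply_mem_toSubmodule g hv, rfl⟩ }
  have f_bot : f ⊥ = ⊥ := Subrepresentation.toSubmodule_injective (Submodule.map_bot _)
  have f_top : f ⊤ = σ := Subrepresentation.toSubmodule_injective (Submodule.map_subtype_top _)
  have f_inj : Function.Injective f := fun a b h =>
    Subrepresentation.toSubmodule_injective
      (Submodule.map_injective_of_injective σ.toSubmodule.subtype_injective
        (congrArg Subrepresentation.toSubmodule h))
  have f_le (τ) : f τ ≤ σ := Submodule.map_subtype_le σ.toSubmodule τ.toSubmodule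
  refine { exists_pair_ne := ⟨⊥, ⊤, fun h => hσ.1 ?_⟩, eq_bot_or_eq_top := fun τ => ?_ }
  · rw [← f_top, ← h, f_bot]
  · rcases hσ.le_iff.1 (f_le τ) with h | h
    · exact Or.inl (f_inj (h.trans f_bot.symm))
    · exact Or.inr (f_inj (h.trans f_top.symm))

theorem FDRep.simple_of {G W : Type} [Group G] [Fintype G] [AddCommGroup W] [Module ℂ W]
    [FiniteDimensional ℂ W] (ρ : Representation ℂ G W) [ρ.IsIrreducible] :
    Simple (FDRep.of ρ) := by
  have := invertibleOfNonzero (NeZero.ne (Nat.card G : ℂ))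
  rw [FDRep.simple_iff_char_is_norm_one]
  have h := Representation.char_orthonormal ρ ρ
  rw [if_pos ⟨.refl ρ⟩, inv_mul_eq_one₀ (NeZero.ne _)] at h
  exact h.symm

theorem Representation.exists_simple_ker_le {G W : Type} [Group G] [Fintype G] [AddCommGroup W]
    [Module ℂ W] [FiniteDimensional ℂ W] (ρ : Representation ℂ G W) {g : G} (hg : g ∉ ρ.ker) :
    ∃ V : FDRep ℂ G, Simple V ∧ ρ.ker ≤ V.ρ.ker ∧ g ∉ V.ρ.ker := by
  by_contra! H
  refine hg (LinearMap.ext fun w => ?_)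
  have hw : ρ.asModuleEquiv.symm w ∈ sSup {S : Submodule ℂ[G] ρ.asModule | IsSimpleModule ℂ[G] S} :=
    IsSemisimpleModule.sSup_simples_eq_top ℂ[G] ρ.asModule ▸ Submodule.mem_top
  rw [sSup_eq_iSup'] at hw
  refine Submodule.iSup_induction _ (motive := fun x : ρ.asModule =>
    ρ g (ρ.asModuleEquiv x) = ρ.asModuleEquiv x) hw ?_ (map_zero (ρ g))
    fun x y hx hy => (map_add (ρ g) _ _).trans (congrArg₂ (· + ·) hx hy)
  rintro ⟨S, hS⟩ x hx
  let σ := Subrepresentation.ofSubmodule' S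
  have hσ : IsAtom σ :=
    (OrderIso.isAtom_iff Subrepresentation.subrepresentationSubmoduleOrderIso.symm S).2
      (isSimpleModule_iff_isAtom.1 hS)
  have := Subrepresentation.isIrreducible_toRepresentation hσ
  have hgσ := H (FDRep.of σ.toRepresentation) (FDRep.simple_of _) fun n hn => by
    rw [MonoidHom.mem_ker] at hn ⊢
    ext v
    exact LinearMap.congr_fun hn (v : W)
  exact congrArg Subtype.val (LinearMap.congr_fun hgσ (⟨x, hx⟩ : σ.toSubmodule))

theorem Subgroup.exists_simple_le_ker {G : Type} [Group G] [Fintype G] (N : Subgroup G) [N.Normal]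
    {g : G} (hg : g ∉ N) :
    ∃ V : FDRep ℂ G, Simple V ∧ N ≤ V.ρ.ker ∧ g ∉ V.ρ.ker := by
  let ρ := Representation.ofMulAction ℂ G (G ⧸ N)
  have hker : ρ.ker = N := by
    ext n
    rw [MonoidHom.mem_ker]
    refine ⟨fun h => ?_, fun h => ?_⟩
    · have h1 := LinearMap.congr_fun h (MonoidAlgebra.single ((1 : G) : G ⧸ N) 1)
      rw [Representation.ofMulAction_single] at h1
      have h2 := MonoidAlgebra.single_left_injective one_ne_zero h1
      rw [MulAction.Quotient.smul_coe, smul_eq_mul, mul_one] at h2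
      exact (QuotientGroup.eq_one_iff n).1 h2
    · refine MonoidAlgebra.lhom_ext' fun x => LinearMap.ext_ring ?_
      rw [LinearMap.comp_apply, LinearMap.comp_apply, MonoidAlgebra.lsingle_apply, Representation.ofMulAction_single]
      induction x using QuotientGroup.induction_on with | H a => ?_
      have : n • (a : G ⧸ N) = a := by
        rw [MulAction.Quotient.smul_coe, smul_eq_mul, QuotientGroup.mk_mul,
          (QuotientGroup.eq_one_iff n).2 h, one_mul]
      rw [this]
      rfl
  rw [← hker] at hg ⊢
  exact ρ.exists_simple_ker_le hg

theorem FDRep.commutator_le_ker {G : Type} [Group G] (V : FDRep ℂ G)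
    (hV : Module.finrank ℂ V ≤ 1) : commutator G ≤ V.ρ.ker := by
  obtain ⟨v, hv⟩ := finrank_le_one_iff.1 hV
  have hcomm (S T : Module.End ℂ V) : S * T = T * S := by
    obtain ⟨s, hs⟩ := hv (S v)
    obtain ⟨t, ht⟩ := hv (T v)
    ext w
    obtain ⟨c, rfl⟩ := hv w
    simp [← hs, ← ht, smul_comm s t]
  rw [commutator_def, Subgroup.commutator_le]
  intro a _ b _
  rw [MonoidHom.mem_ker, commutatorElement_def, mul_assoc, ← mul_inv_rev, map_mul, map_mul V.ρ a,
    hcomm (V.ρ a), ← map_mul, ← map_mul, mul_inv_cancel, map_one]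

open Module Polynomial in
theorem Module.End.eq_one_of_trace_eq_finrank {W : Type*} [AddCommGroup W] [Module ℂ W]
    [FiniteDimensional ℂ W] (T : Module.End ℂ W) {n : ℕ} (hn : n ≠ 0) (hT : T ^ n = 1)
    (h : LinearMap.trace ℂ W T = Module.finrank ℂ W) : T = 1 := by
  have hs : T.charpoly.Splits := IsAlgClosed.splits _
  have hnorm : ∀ z ∈ T.charpoly.roots, ‖z‖ = 1 := by
    intro z hz
    have hz' : T.HasEigenvalue z := by
      rw [Module.End.hasEigenvalue_iff_isRoot_charpoly]
      exact isRoot_of_mem_roots hz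
    obtain ⟨v, hv⟩ := hz'.exists_hasEigenvector
    have h1 := hv.pow_apply n
    rw [hT] at h1
    have h2 : z ^ n = 1 := by
      have : (z ^ n - 1) • v = 0 := by rw [sub_smul, ← h1]; simp
      exact sub_eq_zero.1 ((smul_eq_zero.1 this).resolve_right hv.2)
    exact Complex.norm_eq_one_of_pow_eq_one h2 hn
  have hcard : T.charpoly.roots.card = finrank ℂ W := by
    rw [← hs.natDegree_eq_card_roots, LinearMap.charpoly_natDegree]
  rw [Module.End.trace_eq_sum_roots_charpoly_of_splits hs, ← hcard] at h
  have hre : (T.charpoly.roots.map fun z => 1 - z.re).sum = 0 := by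
    have := congrArg Complex.re h
    rw [← Complex.coe_reAddGroupHom, map_multiset_sum] at this
    simp at this
    simp [this]
  have hone : ∀ z ∈ T.charpoly.roots, z = 1 := by
    intro z hz
    have hnn : ∀ x ∈ T.charpoly.roots.map fun z => 1 - z.re, 0 ≤ x := by
      intro x hx
      obtain ⟨y, hy, rfl⟩ := Multiset.mem_map.1 hx
      have := Complex.re_le_norm y
      rw [hnorm y hy] at this
      linarith
    have h1 : 1 - z.re = 0 :=
      Multiset.all_zero_of_le_zero_le_of_sum_eq_zero hnn hre _
        (Multiset.mem_map_of_mem _ hz)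
    exact Complex.ext (by simpa using (sub_eq_zero.1 h1).symm)
      (Complex.abs_re_eq_norm.1 (by rw [hnorm z hz, ← sub_eq_zero.1 h1, abs_one]))
  have hchar : T.charpoly = (X - C 1) ^ finrank ℂ W := by
    rw [hs.eq_prod_roots_of_monic T.charpoly_monic, Multiset.eq_replicate_of_mem hone, hcard]
    simp
  have hnil : IsNilpotent (T - 1) := ⟨finrank ℂ W, by
    have := T.aeval_self_charpoly
    rw [hchar] at this
    simpa using this⟩
  have hss : T.IsSemisimple := by
    refine Module.End.isSemisimple_of_squarefree_aeval_eq_zero (p := X ^ n - C 1) ?_ (by simp [hT])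
    exact (separable_X_pow_sub_C (1 : ℂ) (by exact_mod_cast hn) one_ne_zero).squarefree
  have hss1 : (T - algebraMap ℂ (Module.End ℂ W) 1).IsSemisimple :=
    Module.End.isSemisimple_sub_algebraMap_iff.2 hss
  rw [map_one] at hss1
  exact sub_eq_zero.1 (Module.End.eq_zero_of_isNilpotent_isSemisimple hnil hss1)

theorem charKer_eq_ker {G : Type} [Group G] [Fintype G] (V : FDRep ℂ G) :
    charKer V = (V.ρ.ker : Set G) := by
  ext g
  refine ⟨fun hg => ?_, fun hg => ?_⟩
  · refine Module.End.eq_one_of_trace_eq_finrank (V.ρ g) (Fintype.card_ne_zero (α := G)) ?_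
      (Eq.trans hg V.char_one)
    rw [← map_pow, pow_card_eq_one, map_one]
  · exact congrArg (LinearMap.trace ℂ V) ((MonoidHom.mem_ker.1 hg).trans (map_one V.ρ).symm)

theorem pow_prime_eq_one_of_card_charKer_eq {p m : ℕ} (hp : p.Prime) {G : Type} [Group G]
    [Fintype G] (hpG : IsPGroup p G)
    (hker : ∀ V : FDRep ℂ G, Simple V → 1 < Module.finrank ℂ V → Nat.card (charKer V) = p ^ m)
    {x : G} (hx : x ∈ commutator G) : x ^ p = 1 := by
  have := Fact.mk hp
  by_contra hxp
  have hcard {V : FDRep ℂ G} (hV : Simple V) {y : G} (hy : y ∈ commutator G) (hyV : y ∉ V.ρ.ker) :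
      Nat.card V.ρ.ker = p ^ m := by
    rw [← hker V hV (not_le.1 fun h => hyV (V.commutator_le_ker h hy)), charKer_eq_ker]
    rfl
  obtain ⟨V, hV, -, hxV⟩ := Subgroup.exists_simple_le_ker (⊥ : Subgroup G) (g := x ^ p) hxp
  set K := V.ρ.ker
  have hK := hcard hV (pow_mem hx p) hxV
  have hpQ : IsPGroup p (G ⧸ K) := hpG.to_quotient K
  have : Nontrivial (G ⧸ K) :=
    ⟨(x ^ p : G), 1, fun h => hxV ((QuotientGroup.eq_one_iff _).1 h)⟩
  have := hpQ.center_nontrivial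
  obtain ⟨z, hz⟩ := exists_prime_orderOf_dvd_card' (G := Subgroup.center (G ⧸ K)) p
    ((hpQ.to_subgroup _).card_eq_or_dvd.resolve_left Finite.one_lt_card.ne')
  have hzp : (z : G ⧸ K) ^ p = 1 := by
    rw [← hz]; exact congrArg Subtype.val (pow_orderOf_eq_one z)
  have hz1 : (z : G ⧸ K) ≠ 1 := fun h =>
    hp.one_lt.ne' (hz.symm.trans (orderOf_eq_one_iff.2 (Subtype.ext h)))
  let Z := Subgroup.zpowers (z : G ⧸ K)
  have hZ : Z.Normal := 
    ⟨fun n hn g => by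
      rwa [(Subgroup.mem_center_iff.1 (Subgroup.zpowers_le.2 z.2 hn) g), mul_inv_cancel_right]⟩
  let M := Z.comap (QuotientGroup.mk' K)
  have hKM : K < M := by
    refine lt_of_le_of_ne (fun k hk => ?_) fun h => ?_
    · rw [Subgroup.mem_comap, QuotientGroup.mk'_apply, (QuotientGroup.eq_one_iff k).2 hk]
      exact one_mem Z
    · obtain ⟨t, ht⟩ := QuotientGroup.mk_surjective (z : G ⧸ K)
      refine hz1 (ht ▸ (QuotientGroup.eq_one_iff t).2 (h ▸ ?_))
      rw [Subgroup.mem_comap, QuotientGroup.mk'_apply, ht]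
      exact Subgroup.mem_zpowers _
  by_cases hGM : commutator G ≤ M
  · obtain ⟨k, hk⟩ := Subgroup.mem_zpowers_iff.1 (hGM hx)
    refine hxV ((QuotientGroup.eq_one_iff (x ^ p)).1 ?_)
    rw [QuotientGroup.mk_pow, ← QuotientGroup.mk'_apply, ← hk, ← zpow_natCast, zpow_comm,
      zpow_natCast, hzp, one_zpow]
  · obtain ⟨y, hy, hyM⟩ := SetLike.not_le_iff_exists.1 hGM
    obtain ⟨W, hW, hMW, hyW⟩ := M.exists_simple_le_ker hyM
    refine (hKM.trans_le hMW).ne (SetLike.coe_injective (Set.eq_of_subset_of_ncard_le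
      (hKM.le.trans hMW) ?_))
    exact ((hcard hW hy hyW).trans hK.symm).le

/-- If every non-linear irreducible complex character of the non-Abelian finite `p`-group
`G` (`p` odd) has kernel of order exactly `p ^ m` for a fixed `m ≥ 1`, then the exponent
of the derived subgroup `G'` equals `p`. -/
theorem exponent_commutator_eq_of_kernels (p m : ℕ) (hp : p.Prime) (hodd : Odd p)
    (hm : 1 ≤ m) (G : Type) [Group G] [Fintype G] (hpG : IsPGroup p G)
    (hnab : ¬ ∀ a b : G, a * b = b * a)
    (hker : ∀ V : FDRep ℂ G, Simple V → 1 < Module.finrank ℂ V →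
      Nat.card (charKer V) = p ^ m) :
    Monoid.exponent ↥(commutator G) = p := by
  have hdvd : Monoid.exponent (commutator G) ∣ p := Monoid.exponent_dvd_of_forall_pow_eq_one
    fun x => Subtype.ext (pow_prime_eq_one_of_card_charKer_eq hp hpG hker x.2)
  refine ((Nat.dvd_prime hp).1 hdvd).resolve_left fun h => hnab fun a b => ?_
  have := Monoid.exp_eq_one_iff.1 h
  have hab : ⁅a, b⁆ ∈ commutator G :=
    Subgroup.commutator_mem_commutator (Subgroup.mem_top a) (Subgroup.mem_top b)
  exact commutatorElement_eq_one_iff_mul_comm.1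
    (congrArg Subtype.val (Subsingleton.elim (⟨_, hab⟩ : commutator G) 1))
end

section
/- Let p be an odd prime and let G be a non-Abelian finite p-group such that every non-linear irreducible complex character of G has kernel of order exactly p^m for a fixed integer m ≥ 1. If G' is the unique normal subgroup of G of order p^{m+1}, then G' is elementary Abelian. -/
open CategoryTheory

/-- An endomorphism of finite order of a finite-dimensional complex vector space whose trace is the
dimension is the identity: its eigenvalues are roots of unity summing to their number. -/
theorem LinearMap.eq_one_of_pow_eq_one_of_trace_eq_finrank {V : Type*} [AddCommGroup V]
    [Module ℂ V] [FiniteDimensional ℂ V] (f : Module.End ℂ V) {n : ℕ} (hn : n ≠ 0)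
    (hf : f ^ n = 1) (htr : LinearMap.trace ℂ V f = Module.finrank ℂ V) : f = 1 := by
  have hsplits : f.charpoly.Splits := IsAlgClosed.splits _
  have hcard : f.charpoly.roots.card = Module.finrank ℂ V := by
    rw [← hsplits.natDegree_eq_card_roots, LinearMap.charpoly_natDegree]
  have hpow : ∀ μ ∈ f.charpoly.roots, μ ^ n = 1 := by
    intro μ hμ
    have hev : f.HasEigenvalue μ :=
      (Module.End.hasEigenvalue_iff_isRoot_charpoly f μ).2 (Polynomial.isRoot_of_mem_roots hμ)
    obtain ⟨v, hv⟩ := hev.exists_hasEigenvector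
    have h := hv.pow_apply n
    rw [hf, Module.End.one_apply] at h
    by_contra hne
    have h0 : (μ ^ n - 1) • v = 0 := by rw [sub_smul, ← h, one_smul, sub_self]
    exact (smul_eq_zero.1 h0).elim (fun h' => hne (sub_eq_zero.1 h')) hv.2
  have hsum : f.charpoly.roots.sum = f.charpoly.roots.card := by
    rw [← Module.End.trace_eq_sum_roots_charpoly_of_splits hsplits, htr, hcard]
  have hre : (f.charpoly.roots.map fun μ => 1 - μ.re).sum = 0 := by
    have h1 : (f.charpoly.roots.map Complex.re).sum = f.charpoly.roots.card := by
      have h := congrArg Complex.reAddGroupHom hsum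
      rw [map_multiset_sum] at h
      simpa using h
    simp [Multiset.sum_map_sub, h1]
  have hone : ∀ μ ∈ f.charpoly.roots, μ = 1 := by
    intro μ hμ
    have hnorm : ∀ ν ∈ f.charpoly.roots, ‖ν‖ = 1 := fun ν hν =>
      Complex.norm_eq_one_of_pow_eq_one (hpow ν hν) hn
    have hnonneg : ∀ x ∈ f.charpoly.roots.map fun μ => 1 - μ.re, (0 : ℝ) ≤ x := by
      intro x hx
      obtain ⟨ν, hν, rfl⟩ := Multiset.mem_map.1 hx
      have := Complex.re_le_norm ν
      rw [hnorm ν hν] at this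
      linarith
    have h0 : μ.re = 1 := by
      have := Multiset.all_zero_of_le_zero_le_of_sum_eq_zero hnonneg hre _
        (Multiset.mem_map_of_mem _ hμ)
      linarith
    have h1 := Complex.sq_norm μ
    rw [hnorm μ hμ, Complex.normSq_apply, h0] at h1
    have him : μ.im = 0 := by nlinarith
    exact Complex.ext h0 him
  have hchar : f.charpoly = (Polynomial.X - Polynomial.C 1) ^ Module.finrank ℂ V := by
    have h := hsplits.eq_prod_roots_of_monic f.charpoly_monic
    rw [Multiset.eq_replicate.2 ⟨hcard, hone⟩] at h
    simpa using h
  have hnil : IsNilpotent (f - algebraMap ℂ _ 1) := by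
    refine ⟨Module.finrank ℂ V, ?_⟩
    have h := f.aeval_self_charpoly
    rw [hchar] at h
    simpa using h
  have hss : f.IsSemisimple := by
    refine Module.End.isSemisimple_of_squarefree_aeval_eq_zero
      (p := Polynomial.X ^ n - Polynomial.C 1) ?_ (by simp [hf])
    exact (Polynomial.separable_X_pow_sub_C (1 : ℂ) (by exact_mod_cast hn) one_ne_zero).squarefree
  have h := Module.End.eq_zero_of_isNilpotent_isSemisimple hnil
    ((Module.End.isSemisimple_sub_algebraMap_iff).2 hss)
  simpa [sub_eq_zero] using h

theorem mem_charKer_iff {G : Type} [Group G] [Finite G] (V : FDRep ℂ G) (g : G) :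
    g ∈ charKer V ↔ g ∈ V.ρ.ker := by
  rw [MonoidHom.mem_ker]
  refine ⟨fun h => ?_, fun h => ?_⟩
  · refine LinearMap.eq_one_of_pow_eq_one_of_trace_eq_finrank (V.ρ g) (orderOf_pos g).ne' ?_ ?_
    · rw [← map_pow, pow_orderOf_eq_one, map_one]
    · have h' : V.character g = V.character 1 := h
      rwa [FDRep.char_one] at h'
  · change LinearMap.trace ℂ V (V.ρ g) = LinearMap.trace ℂ V (V.ρ 1)
    rw [MonoidHom.map_one, h]

theorem FDRep.simple_of_isIrreducible {G V : Type} [Group G] [Finite G] [AddCommGroup V]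
    [Module ℂ V] [FiniteDimensional ℂ V] (ρ : Representation ℂ G V)
    [Representation.IsIrreducible ρ] : Simple (FDRep.of ρ) := by
  rw [FDRep.simple_iff_end_is_rank_one,
    ← (FDRep.forget₂HomLinearEquiv (FDRep.of ρ) (FDRep.of ρ)).finrank_eq,
    ← Representation.IsIrreducible.finrank_intertwiningMap_self ρ]
  exact LinearEquiv.finrank_eq
    { toFun := Rep.Hom.hom
      invFun := Rep.ofHom
      map_add' := fun _ _ => rfl
      map_smul' := fun _ _ => rfl }

open scoped MonoidAlgebra in
theorem FDRep.smul_eq_self_of_isSimpleModule {G : Type} [Group G] [Finite G] {g : G} (M : Type)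
    [AddCommGroup M] [Module ℂ[G] M] [IsSimpleModule ℂ[G] M]
    (h : ∀ V : FDRep ℂ G, Simple V → V.ρ g = 1) (x : M) : MonoidAlgebra.of ℂ G g • x = x := by
  have := (Representation.isSimpleModule_iff_irreducible_ofModule (k := ℂ) (G := G) M).1 ‹_›
  have hfin : @Module.Finite ℂ M _ _ (Module.compHom M (algebraMap ℂ ℂ[G])) := by
    let : Module ℂ M := Module.compHom M (algebraMap ℂ ℂ[G])
    have : IsScalarTower ℂ ℂ[G] M := IsScalarTower.of_algebraMap_smul fun _ _ => rfl
    exact Module.Finite.trans ℂ[G] M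
  let : @Module ℂ (RestrictScalars ℂ ℂ[G] M) _ AddCommGroup.toAddCommMonoid :=
    RestrictScalars.module ℂ ℂ[G] M
  have : FiniteDimensional ℂ (RestrictScalars ℂ ℂ[G] M) := hfin
  have h₁ : Representation.ofModule (k := ℂ) (G := G) M g = 1 :=
    h (FDRep.of (Representation.ofModule (k := ℂ) (G := G) M)) (FDRep.simple_of_isIrreducible _)
  have h₂ := LinearMap.congr_fun h₁ ((RestrictScalars.addEquiv ℂ ℂ[G] M).symm x)
  exact congrArg (RestrictScalars.addEquiv ℂ ℂ[G] M) h₂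

open scoped MonoidAlgebra in
/-- The irreducible complex representations of a finite group separate its elements. -/
theorem FDRep.exists_simple_apply_ne_one {G : Type} [Group G] [Finite G] {g : G} (hg : g ≠ 1) :
    ∃ V : FDRep ℂ G, Simple V ∧ V.ρ g ≠ 1 := by
  by_contra! hcon
  let a : ℂ[G] := MonoidAlgebra.of ℂ G g
  have key : ∀ S : Submodule ℂ[G] ℂ[G], IsSimpleModule ℂ[G] S → ∀ x ∈ S, a • x = x :=
    fun S hS x hx => by
      have := FDRep.smul_eq_self_of_isSimpleModule S hcon ⟨x, hx⟩
      exact congrArg Subtype.val this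
  have hall : ∀ x : ℂ[G], a * x = x := by
    intro x
    have hx : x ∈ sSup {S : Submodule ℂ[G] ℂ[G] | IsSimpleModule ℂ[G] S} := by
      rw [IsSemisimpleModule.sSup_simples_eq_top]; trivial
    rw [sSup_eq_iSup'] at hx
    induction hx using Submodule.iSup_induction' with
    | mem S x hx => exact key S.1 S.2 x hx
    | zero => simp
    | add x y _ _ hx hy => rw [mul_add, hx, hy]
  have h1 := hall 1
  rw [mul_one] at h1
  exact hg (MonoidAlgebra.of_injective (h1.trans (map_one (MonoidAlgebra.of ℂ G)).symm))

theorem FDRep.one_lt_finrank_of_mem_commutator {G : Type} [Group G] (V : FDRep ℂ G) {x : G}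
    (hx : x ∈ commutator G) (hV : V.ρ x ≠ 1) : 1 < Module.finrank ℂ V := by
  by_contra! hle
  refine hV ?_
  have hcomm : ∀ f g : V →ₗ[ℂ] V, f * g = g * f := by
    obtain h | h := Nat.le_one_iff_eq_zero_or_eq_one.1 hle
    · have := Module.finrank_zero_iff.1 h
      exact fun f g => LinearMap.ext fun v => Subsingleton.elim _ _
    · obtain ⟨v, hv, hspan⟩ := finrank_eq_one_iff'.1 h
      intro f g
      obtain ⟨a, ha⟩ := hspan (f v)
      obtain ⟨b, hb⟩ := hspan (g v)
      refine LinearMap.ext fun w => ?_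
      obtain ⟨c, rfl⟩ := hspan w
      simp only [Module.End.mul_apply, map_smul, ← ha, ← hb, smul_comm a b]
  have hker : commutator G ≤ V.ρ.ker := by
    rw [commutator_eq_closure, Subgroup.closure_le]
    rintro _ ⟨a, b, rfl⟩
    rw [SetLike.mem_coe, MonoidHom.mem_ker, commutatorElement_def, map_mul, map_mul, map_mul,
      hcomm (V.ρ a), mul_assoc (V.ρ b), ← map_mul V.ρ a, mul_inv_cancel, map_one, mul_one,
      ← map_mul, mul_inv_cancel, map_one]
  exact hker hx

/-- A proper normal subgroup `K` of a finite `p`-group lies in a normal subgroup `N` such that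
`N / K` has order `p`. -/
theorem IsPGroup.exists_normal_card_eq_mul {G : Type*} [Group G] [Finite G] {p : ℕ}
    [hp : Fact p.Prime] (hG : IsPGroup p G) (K : Subgroup G) [K.Normal] (hK : K ≠ ⊤) :
    ∃ z : G ⧸ K, orderOf z = p ∧
      ((Subgroup.zpowers z).comap (QuotientGroup.mk' K)).Normal ∧
      Nat.card ((Subgroup.zpowers z).comap (QuotientGroup.mk' K)) = Nat.card K * p := by
  have hQ : IsPGroup p (G ⧸ K) := hG.to_quotient K
  have : Nontrivial (G ⧸ K) := QuotientGroup.nontrivial_iff.2 hK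
  have hnt := hQ.center_nontrivial
  have hZ : IsPGroup p (Subgroup.center (G ⧸ K)) := hQ.to_subgroup _
  have hdvd : p ∣ Nat.card (Subgroup.center (G ⧸ K)) :=
    hZ.card_eq_or_dvd.resolve_left Finite.one_lt_card.ne'
  obtain ⟨⟨z, hzc⟩, hz⟩ := exists_prime_orderOf_dvd_card' p hdvd
  rw [Subgroup.orderOf_mk] at hz
  have hnormal : (Subgroup.zpowers z).Normal := by
    refine ⟨fun n hn g => ?_⟩
    have hn' : n ∈ Subgroup.center (G ⧸ K) := (Subgroup.zpowers_le.2 hzc) hn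
    rwa [Subgroup.mem_center_iff.1 hn' g, mul_inv_cancel_right]
  refine ⟨z, hz, hnormal.comap _, ?_⟩
  rw [← hz, ← Nat.card_zpowers, ← Nat.card_prod]
  exact Nat.card_congr (QuotientGroup.preimageMkEquivSubgroupProdSet K (Subgroup.zpowers z))

/-- If every non-linear irreducible complex character of the non-Abelian finite `p`-group
`G` (`p` odd) has kernel of order exactly `p ^ m` (`m ≥ 1`), and `G'` is the unique
normal subgroup of `G` of order `p^{m+1}`, then `G'` is elementary Abelian. -/
theorem commutator_elementaryAbelian_of_unique (p m : ℕ) (hp : p.Prime) (hodd : Odd p)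
    (hm : 1 ≤ m) (G : Type) [Group G] [Fintype G] (hpG : IsPGroup p G)
    (hnab : ¬ ∀ a b : G, a * b = b * a)
    (hker : ∀ V : FDRep ℂ G, Simple V → 1 < Module.finrank ℂ V →
      Nat.card (charKer V) = p ^ m)
    (hcard : Nat.card (commutator G) = p ^ (m + 1))
    (huniq : ∀ N : Subgroup G, N.Normal → Nat.card N = p ^ (m + 1) → N = commutator G) :
    (∀ x y : ↥(commutator G), x * y = y * x) ∧
      (∀ x : ↥(commutator G), x ^ p = 1) := by
  have : Fact p.Prime := ⟨hp⟩
  have key : ∀ y : G, y ∈ commutator G →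
      (∀ (K : Subgroup G) [K.Normal] (z : G ⧸ K), orderOf z = p →
        (∀ x ∈ commutator G, (x : G ⧸ K) ∈ Subgroup.zpowers z) → y ∈ K) → y = 1 := by
    intro y hy h
    by_contra hne
    obtain ⟨V, hV, hVy⟩ := FDRep.exists_simple_apply_ne_one hne
    have hset : charKer V = (V.ρ.ker : Set G) := Set.ext (mem_charKer_iff V)
    have hK : Nat.card V.ρ.ker = p ^ m := by
      have := hker V hV (V.one_lt_finrank_of_mem_commutator hy hVy)
      rwa [hset] at this
    have htop : V.ρ.ker ≠ ⊤ := fun htop =>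
      hVy (MonoidHom.mem_ker.1 (htop ▸ Subgroup.mem_top y))
    obtain ⟨z, hz, hnormal, hN⟩ := hpG.exists_normal_card_eq_mul V.ρ.ker htop
    have hcomm := huniq _ hnormal (by rw [hN, hK, pow_succ])
    exact hVy (h V.ρ.ker z hz fun x hx => by
      rw [← hcomm] at hx
      exact hx)
  refine ⟨fun x y => Subtype.ext ?_, fun x => Subtype.ext ?_⟩
  · rw [Subgroup.coe_mul, Subgroup.coe_mul, ← commutatorElement_eq_one_iff_mul_comm]
    refine key _ (Subgroup.commutator_mem_commutator (Subgroup.mem_top _) (Subgroup.mem_top _)) ?_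
    intro K hKn z _ h
    obtain ⟨i, hi⟩ := h x x.2
    obtain ⟨j, hj⟩ := h y y.2
    rw [← QuotientGroup.eq_one_iff]
    open scoped commutatorElement in change ⁅((x : G) : G ⧸ K), ((y : G) : G ⧸ K)⁆ = 1
    rw [commutatorElement_eq_one_iff_mul_comm, ← hi, ← hj]
    exact (Commute.refl z).zpow_zpow i j
  · refine key _ (pow_mem x.2 p) ?_
    intro K _ z hz h
    obtain ⟨i, hi⟩ := h x x.2
    rw [← QuotientGroup.eq_one_iff]
    change ((x : G) : G ⧸ K) ^ p = 1
    rw [← hi, ← hz]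
    change (z ^ i) ^ orderOf z = 1
    rw [← zpow_natCast, zpow_comm, zpow_natCast, pow_orderOf_eq_one, one_zpow]
end
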